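/- For every L > 0 there exists a constant C_L > 0 such that for all real a > 0 and all T, λ > 0 with Tλ ≤ L, the drift magnitude b̄_T^λ(a) := −(d/da H̄_T^λ(a)) / (1 + H̄_T^λ(a)) satisfies b̄_T^λ(a) ≤ (C_L / a) · ( (e^{−a²/(2T)} / (1 + log⁺(1/(Tλ)))) if a² ≥ 2T²λ, and (1 / (1 + log⁺(2T/a²))) if a² < 2T²λ ). -/

import Mathlib

open MeasureTheory Real

/-- The Volterra function `ν(x) = ∫₀^∞ x^s / Γ(s+1) ds` (for `x > 0`; `ν(0) = 0`). -/
noncomputable def volterra (x : ℝ) : ℝ := ∫ s in Set.Ioi (0 : ℝ), x ^ s / Real.Gamma (s + 1)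

/-- `H̄_T^λ(a) = ∫₀^T (e^{−a²/(2r)} / r) ν((T−r)λ) dr`. -/
noncomputable def Hbar (T lam a : ℝ) : ℝ :=
  ∫ r in (0 : ℝ)..T, Real.exp (-(a ^ 2 / (2 * r))) / r * volterra ((T - r) * lam)

/-- The drift magnitude `b̄_T^λ(a) = −(d/da H̄_T^λ(a)) / (1 + H̄_T^λ(a))`. -/
noncomputable def bbar (T lam a : ℝ) : ℝ :=
  -(deriv (fun a' => Hbar T lam a') a) / (1 + Hbar T lam a)

/-- `log⁺ u = max (log u) 0`. -/
noncomputable def logPlus (u : ℝ) : ℝ := max (Real.log u) 0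

open Set Filter Topology

lemma logPlus_nonneg (u : ℝ) : 0 ≤ logPlus u := le_max_right _ _

lemma pow_mul_exp_neg_le_Gamma {K s : ℝ} (hK : 0 < K) (hs : 0 < s) :
    K ^ s * exp (-K) ≤ Gamma (s + 1) := by
  have hint := Real.GammaIntegral_convergent (s := s + 1) (by linarith)
  rw [Real.Gamma_eq_integral (by linarith), ← integral_exp_neg_Ioi K, ← integral_const_mul]
  refine (setIntegral_mono_on ((integrableOn_exp_neg_Ioi K).const_mul _)
    (hint.mono_set (Ioi_subset_Ioi hK.le)) measurableSet_Ioi fun t ht => ?_).trans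
    (setIntegral_mono_set hint ?_ (Ioi_subset_Ioi hK.le).eventuallyLE)
  · rw [mul_comm, add_sub_cancel_right]
    gcongr
    exact ht.le
  · filter_upwards [ae_restrict_mem measurableSet_Ioi] with t ht
    have : (0 : ℝ) < t := ht
    simp only [Pi.zero_apply]
    positivity

lemma rpow_div_Gamma_nonneg {x s : ℝ} (hx : 0 ≤ x) (hs : 0 < s) : 0 ≤ x ^ s / Gamma (s + 1) :=
  div_nonneg (rpow_nonneg hx s) (Gamma_pos_of_pos (by linarith)).le

lemma rpow_div_Gamma_le {M x s : ℝ} (hM : 1 ≤ M) (hx : 0 ≤ x) (hxM : x ≤ M) (hs : 0 < s) :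
    x ^ s / Gamma (s + 1) ≤
      exp (exp 1 * M) * exp (-(1 + logPlus (1 / x)) * s) := by
  rcases hx.eq_or_lt with rfl | hx
  · rw [zero_rpow hs.ne', zero_div]
    positivity
  have hM0 : 0 < M := by linarith
  have hK : 0 < exp 1 * M := by positivity
  rw [div_le_iff₀ (Gamma_pos_of_pos (by linarith))]
  refine le_trans ?_ (mul_le_mul_of_nonneg_left (pow_mul_exp_neg_le_Gamma hK hs) (by positivity))
  rw [rpow_def_of_pos hx, rpow_def_of_pos hK, ← exp_add, ← exp_add, ← exp_add, exp_le_exp,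
    log_mul (exp_pos 1).ne' hM0.ne', log_exp]
  have h : log x + logPlus (1 / x) ≤ log M := by
    rw [logPlus, one_div, log_inv]
    rcases max_cases (-log x) 0 with h | h
    · rw [h.1]
      linarith [log_nonneg hM]
    · rw [h.1]
      linarith [log_le_log hx hxM]
  nlinarith [mul_le_mul_of_nonneg_right h hs.le]

lemma integrableOn_exp_neg_logPlus (x c : ℝ) :
    IntegrableOn (fun s => c * exp (-(1 + logPlus (1 / x)) * s)) (Ioi 0) :=
  (integrableOn_exp_mul_Ioi (by linarith [logPlus_nonneg (1 / x)]) 0).const_mul _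

lemma integrableOn_rpow_div_Gamma {x : ℝ} (hx : 0 ≤ x) :
    IntegrableOn (fun s => x ^ s / Gamma (s + 1)) (Ioi 0) := by
  refine Integrable.mono' (integrableOn_exp_neg_logPlus x (exp (exp 1 * max 1 x))) ?_ ?_
  · refine ContinuousOn.aestronglyMeasurable (fun s hs => ?_) measurableSet_Ioi
    have hs : (0 : ℝ) < s := hs
    refine ContinuousAt.continuousWithinAt ?_
    refine ContinuousAt.div (continuousAt_const_rpow' hs.ne') ?_
      (Gamma_pos_of_pos (by linarith)).ne'
    refine ContinuousAt.comp (g := Gamma) (f := fun s : ℝ => s + 1)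
      (differentiableAt_Gamma fun m => ?_).continuousAt (by fun_prop)
    have : (0 : ℝ) ≤ m := m.cast_nonneg
    linarith
  · filter_upwards [ae_restrict_mem measurableSet_Ioi] with s hs
    rw [Real.norm_of_nonneg (rpow_div_Gamma_nonneg hx hs)]
    exact rpow_div_Gamma_le (le_max_left _ _) hx (le_max_right _ _) hs

lemma volterra_nonneg {x : ℝ} (hx : 0 ≤ x) : 0 ≤ volterra x :=
  setIntegral_nonneg measurableSet_Ioi fun _ hs => rpow_div_Gamma_nonneg hx hs

lemma volterra_monotoneOn : MonotoneOn volterra (Ici 0) := fun x hx y hy hxy => by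
  have hx : 0 ≤ x := hx
  refine setIntegral_mono_on (integrableOn_rpow_div_Gamma hx) (integrableOn_rpow_div_Gamma hy)
    measurableSet_Ioi fun s hs => ?_
  have hs : (0 : ℝ) < s := hs
  have := Gamma_pos_of_pos (show 0 < s + 1 by linarith)
  gcongr

lemma volterra_le {M x : ℝ} (hM : 1 ≤ M) (hx : 0 ≤ x) (hxM : x ≤ M) :
    volterra x ≤ exp (exp 1 * M) / (1 + logPlus (1 / x)) := by
  have hq : -(1 + logPlus (1 / x)) < 0 := by linarith [logPlus_nonneg (1 / x)]
  calc volterra x ≤ ∫ s in Ioi (0 : ℝ), exp (exp 1 * M) * exp (-(1 + logPlus (1 / x)) * s) :=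
        setIntegral_mono_on (integrableOn_rpow_div_Gamma hx) (integrableOn_exp_neg_logPlus x _)
          measurableSet_Ioi fun s hs => rpow_div_Gamma_le hM hx hxM hs
    _ = _ := by
        rw [integral_const_mul, integral_exp_mul_Ioi hq, mul_zero, exp_zero, neg_div_neg_eq,
          mul_one_div]

lemma Gamma_le_one {t : ℝ} (h1 : 1 ≤ t) (h2 : t ≤ 2) : Gamma t ≤ 1 := by
  have h := convexOn_Gamma.2 (x := 1) (y := 2) (by norm_num) (by norm_num)
    (show 0 ≤ 2 - t by linarith) (show 0 ≤ t - 1 by linarith) (by ring)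
  simp only [smul_eq_mul, Gamma_one, Gamma_two] at h
  rwa [show (2 - t) * 1 + (t - 1) * 2 = t by ring,
    show (2 - t) * 1 + (t - 1) * 1 = 1 by ring] at h

lemma le_volterra {x : ℝ} (hx : 0 < x) :
    exp (-1) / (1 + logPlus (1 / x)) ≤ volterra x := by
  set q := 1 + logPlus (1 / x) with hqdef
  have hq : 1 ≤ q := by linarith [logPlus_nonneg (1 / x)]
  have hq0 : 0 < q := by linarith
  have hsub : Ioc 0 (1 / q) ⊆ Ioi (0 : ℝ) := Ioc_subset_Ioi_self
  have hint := integrableOn_rpow_div_Gamma hx.le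
  calc exp (-1) / q = ∫ _ in Ioc 0 (1 / q), exp (-1) := by
        rw [setIntegral_const, measureReal_def, Real.volume_Ioc, sub_zero,
          ENNReal.toReal_ofReal (by positivity), smul_eq_mul]
        ring
    _ ≤ ∫ s in Ioc 0 (1 / q), x ^ s / Gamma (s + 1) := by
        refine setIntegral_mono_on (by simp) (hint.mono_set hsub) measurableSet_Ioc
          fun s hs => ?_
        have hs1 : s * q ≤ 1 := (le_div_iff₀ hq0).1 hs.2
        have hs2 : s ≤ 1 := by nlinarith [hs.1]
        have hl : -q ≤ log x := by
          have : -log x ≤ logPlus (1 / x) := by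
            rw [logPlus, one_div, log_inv]
            exact le_max_left _ _
          linarith
        rw [le_div_iff₀ (Gamma_pos_of_pos (by linarith [hs.1])), rpow_def_of_pos hx]
        refine (mul_le_of_le_one_right (exp_pos _).le
          (Gamma_le_one (by linarith [hs.1]) (by linarith))).trans (exp_le_exp.2 ?_)
        nlinarith [hs.1]
    _ ≤ volterra x := by
        refine setIntegral_mono_set hint ?_ hsub.eventuallyLE
        filter_upwards [ae_restrict_mem measurableSet_Ioi] with s hs
        exact rpow_div_Gamma_nonneg hx.le hs

lemma le_volterra_half {x : ℝ} (hx : 0 < x) :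
    exp (-1) / (2 * (1 + logPlus (1 / x))) ≤ volterra (x / 2) := by
  refine le_trans ?_ (le_volterra (half_pos hx))
  have h0 := logPlus_nonneg (1 / x)
  have h0' := logPlus_nonneg (1 / (x / 2))
  gcongr
  have h : logPlus (1 / (x / 2)) ≤ 1 + logPlus (1 / x) := by
    unfold logPlus
    rw [one_div, one_div, log_inv, log_inv, log_div hx.ne' two_ne_zero]
    have := log_two_lt_d9
    refine max_le ?_ ?_
    · linarith [le_max_left (-log x) 0]
    · linarith [le_max_right (-log x) 0]
  linarith

section

variable {T lam a : ℝ}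

lemma volterra_le_of_mem (hlam : 0 < lam) {r : ℝ} (hr : r ∈ Ioc 0 T) :
    volterra ((T - r) * lam) ≤ volterra (T * lam) := by
  have h1 : 0 ≤ T - r := by linarith [hr.2]
  have h2 : 0 ≤ T := hr.1.le.trans hr.2
  refine volterra_monotoneOn (mem_Ici.2 (by positivity)) (mem_Ici.2 (by positivity)) ?_
  gcongr
  linarith [hr.1]

lemma volterra_nonneg_of_mem (hlam : 0 < lam) {r : ℝ} (hr : r ∈ Ioc 0 T) :
    0 ≤ volterra ((T - r) * lam) :=
  volterra_nonneg (mul_nonneg (by linarith [hr.2]) hlam.le)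

lemma exp_neg_div_le (ha : 0 < a) {r : ℝ} (hr : 0 < r) :
    exp (-(a ^ 2 / (2 * r))) / r ≤ 2 / a ^ 2 := by
  have h := add_one_le_exp (a ^ 2 / (2 * r))
  rw [exp_neg, div_le_div_iff₀ hr (by positivity), inv_mul_le_iff₀ (exp_pos _)]
  have h2 : a ^ 2 = a ^ 2 / (2 * r) * (2 * r) := by field_simp
  nlinarith

lemma exp_neg_div_sq_le (ha : 0 < a) {r : ℝ} (hr : 0 < r) :
    exp (-(a ^ 2 / (2 * r))) / r ^ 2 ≤ 8 / a ^ 4 := by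
  have ht : 0 ≤ a ^ 2 / (2 * r) := by positivity
  have h := quadratic_le_exp_of_nonneg ht
  rw [exp_neg, div_le_div_iff₀ (by positivity) (by positivity), inv_mul_le_iff₀ (exp_pos _)]
  have h2 : a ^ 4 = (a ^ 2 / (2 * r)) ^ 2 * (4 * r ^ 2) := by
    field_simp
    ring
  rw [h2]
  nlinarith [mul_le_mul_of_nonneg_right h (sq_nonneg r), mul_nonneg ht (sq_nonneg r), sq_nonneg r]

lemma integrableOn_Hbar (hlam : 0 < lam) (ha : 0 < a) :
    IntegrableOn (fun r => exp (-(a ^ 2 / (2 * r))) / r * volterra ((T - r) * lam)) (Ioc 0 T) := by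
  refine Integrable.of_bound (C := 2 / a ^ 2 * volterra (T * lam)) ?_ ?_
  · refine AEStronglyMeasurable.mul (Measurable.aestronglyMeasurable (by fun_prop)) ?_
    suffices hanti : AntitoneOn (fun r => volterra ((T - r) * lam)) (Ioc 0 T) from
      (aemeasurable_restrict_of_antitoneOn measurableSet_Ioc hanti).aestronglyMeasurable
    intro r hr r' hr' h
    refine volterra_monotoneOn (mem_Ici.2 (mul_nonneg (by linarith [hr'.2]) hlam.le))
      (mem_Ici.2 (mul_nonneg (by linarith [hr.2]) hlam.le)) ?_
    gcongr
  · filter_upwards [ae_restrict_mem measurableSet_Ioc] with r hr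
    have hv := volterra_nonneg_of_mem hlam hr
    have hr0 := hr.1
    rw [Real.norm_of_nonneg (by positivity)]
    exact mul_le_mul (exp_neg_div_le ha hr.1) (volterra_le_of_mem hlam hr) hv (by positivity)

lemma Hbar_eq (hT : 0 < T) : Hbar T lam a =
    ∫ r in Ioc 0 T, exp (-(a ^ 2 / (2 * r))) / r * volterra ((T - r) * lam) :=
  intervalIntegral.integral_of_le hT.le

lemma Hbar_nonneg (hT : 0 < T) (hlam : 0 < lam) : 0 ≤ Hbar T lam a := by
  rw [Hbar_eq hT]
  refine setIntegral_nonneg measurableSet_Ioc fun r hr => ?_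
  have hv := volterra_nonneg_of_mem hlam hr
  have hr0 := hr.1
  positivity

lemma integrableOn_exp_neg_div_sq (ha : 0 < a) :
    IntegrableOn (fun r => exp (-(a ^ 2 / (2 * r))) / r ^ 2) (Ioc 0 T) := by
  refine Measure.integrableOn_of_bounded (M := 8 / a ^ 4) (by simp)
    (Measurable.aestronglyMeasurable (by fun_prop)) ?_
  filter_upwards [ae_restrict_mem measurableSet_Ioc] with r hr
  have hr0 := hr.1
  rw [Real.norm_of_nonneg (by positivity)]
  exact exp_neg_div_sq_le ha hr.1

lemma integral_exp_neg_div_sq (hT : 0 < T) (ha : 0 < a) :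
    ∫ r in Ioc 0 T, exp (-(a ^ 2 / (2 * r))) / r ^ 2 = 2 / a ^ 2 * exp (-(a ^ 2 / (2 * T))) := by
  have hd : ∀ r : ℝ, 0 < r → HasDerivAt (fun r => 2 / a ^ 2 * exp (-(a ^ 2 / (2 * r))))
      (exp (-(a ^ 2 / (2 * r))) / r ^ 2) r := fun r hr => by
    have h := ((((hasDerivAt_id r).const_mul 2).inv (by simpa using hr.ne')).const_mul
      (a ^ 2)).neg.exp.const_mul (2 / a ^ 2)
    simp only [id, Pi.inv_apply, Pi.neg_apply, ← div_eq_mul_inv] at h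
    refine h.congr_deriv ?_
    field_simp
  have h0 : Tendsto (fun r => 2 / a ^ 2 * exp (-(a ^ 2 / (2 * r)))) (𝓝[>] 0) (𝓝 0) := by
    have h1 : Tendsto (fun r : ℝ => a ^ 2 / 2 * r⁻¹) (𝓝[>] 0) atTop :=
      tendsto_inv_nhdsGT_zero.const_mul_atTop (by positivity)
    have h2 := (tendsto_exp_neg_atTop_nhds_zero.comp h1).const_mul (2 / a ^ 2)
    rw [mul_zero] at h2
    refine h2.congr fun r => ?_
    simp only [Function.comp]
    congr 3
    rw [div_mul_eq_div_div, div_eq_mul_inv (a ^ 2 / 2)]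
  have hi := integrableOn_exp_neg_div_sq (T := T) ha
  rw [← intervalIntegral.integral_of_le hT.le,
    intervalIntegral.integral_eq_sub_of_hasDerivAt_of_tendsto hT (fun r hr => hd r hr.1)
      ((intervalIntegrable_iff_integrableOn_Ioc_of_le hT.le).2 hi) h0
      ((hd T hT).continuousAt.tendsto.mono_left nhdsWithin_le_nhds), sub_zero]

lemma Hbar_sub_le (hT : 0 < T) (hlam : 0 < lam) (ha : 0 < a) {b : ℝ} (hab : a < b) :
    Hbar T lam a - Hbar T lam b ≤
      (b ^ 2 - a ^ 2) / a ^ 2 * volterra (T * lam) * exp (-(a ^ 2 / (2 * T))) := by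
  have hb : 0 < b := ha.trans hab
  rw [Hbar_eq hT, Hbar_eq hT, ← integral_sub (integrableOn_Hbar hlam ha) (integrableOn_Hbar hlam hb)]
  calc _ ≤ ∫ r in Ioc 0 T, (b ^ 2 - a ^ 2) / 2 * volterra (T * lam) *
        (exp (-(a ^ 2 / (2 * r))) / r ^ 2) := by
        refine setIntegral_mono_on
          ((integrableOn_Hbar hlam ha).sub (integrableOn_Hbar hlam hb))
          ((integrableOn_exp_neg_div_sq ha).const_mul _) measurableSet_Ioc fun r hr => ?_
        have hr0 := hr.1
        have hv := volterra_nonneg_of_mem hlam hr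
        have hba : 0 ≤ b ^ 2 - a ^ 2 := by nlinarith
        have h := add_one_le_exp (-((b ^ 2 - a ^ 2) / (2 * r)))
        have hexp : exp (-(b ^ 2 / (2 * r))) =
            exp (-(a ^ 2 / (2 * r))) * exp (-((b ^ 2 - a ^ 2) / (2 * r))) := by
          rw [← exp_add]
          congr 1
          ring
        calc _ = exp (-(a ^ 2 / (2 * r))) / r * (1 - exp (-((b ^ 2 - a ^ 2) / (2 * r)))) *
              volterra ((T - r) * lam) := by
              rw [hexp]
              ring
          _ ≤ exp (-(a ^ 2 / (2 * r))) / r * ((b ^ 2 - a ^ 2) / (2 * r)) *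
              volterra (T * lam) := by
              have := volterra_le_of_mem hlam hr
              gcongr
              linarith
          _ = _ := by
              field_simp
    _ = _ := by
        rw [integral_const_mul, integral_exp_neg_div_sq hT ha]
        field_simp

lemma neg_deriv_Hbar_le (hT : 0 < T) (hlam : 0 < lam) (ha : 0 < a) :
    -deriv (fun a' => Hbar T lam a') a ≤
      2 / a * volterra (T * lam) * exp (-(a ^ 2 / (2 * T))) := by
  have hv : 0 ≤ volterra (T * lam) := volterra_nonneg (by positivity)
  by_cases hd : DifferentiableAt ℝ (fun a' => Hbar T lam a') a
  swap
  · rw [deriv_zero_of_not_differentiableAt hd, neg_zero]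
    positivity
  have h1 := (hasDerivAt_iff_tendsto_slope.1 hd.hasDerivAt).mono_left
    (nhdsWithin_mono a (fun b (hb : a < b) => hb.ne') : 𝓝[>] a ≤ 𝓝[≠] a)
  have h2 : Tendsto (fun b => (b + a) / a ^ 2 * volterra (T * lam) * exp (-(a ^ 2 / (2 * T))))
      (𝓝[>] a) (𝓝 ((a + a) / a ^ 2 * volterra (T * lam) * exp (-(a ^ 2 / (2 * T))))) := by
    refine Tendsto.mono_left (Continuous.tendsto ?_ a) nhdsWithin_le_nhds
    fun_prop
  have h3 := le_of_tendsto_of_tendsto h1.neg h2 (by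
    filter_upwards [self_mem_nhdsWithin] with b hb
    have hb : 0 < b - a := sub_pos.2 hb
    have h := Hbar_sub_le hT hlam ha (sub_pos.1 hb)
    rw [slope_def_field, ← neg_div, neg_sub, div_le_iff₀ hb]
    refine h.trans_eq ?_
    ring)
  refine h3.trans_eq ?_
  field_simp
  ring

lemma le_Hbar (hT : 0 < T) (hlam : 0 < lam) (ha : 0 < a) (hp : a ^ 2 / (2 * T) ≤ 1 / 2) :
    exp (-1) * volterra (T * lam / 2) * (log (2 * T / a ^ 2) - log 2) ≤ Hbar T lam a := by
  set p := a ^ 2 / (2 * T) with hpdef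
  have hp0 : 0 < p := by positivity
  have hlow : 0 < p * T := by positivity
  have hle : p * T ≤ T / 2 := by nlinarith
  have hsub : Ioc (p * T) (T / 2) ⊆ Ioc 0 T := Ioc_subset_Ioc hlow.le (by linarith)
  have hint := integrableOn_Hbar (T := T) hlam ha
  rw [Hbar_eq hT]
  calc _ = ∫ r in Ioc (p * T) (T / 2), exp (-1) * volterra (T * lam / 2) * r⁻¹ := by
        rw [integral_const_mul, ← intervalIntegral.integral_of_le hle,
          integral_inv_of_pos hlow (by positivity), ← log_div (by positivity) two_ne_zero]
        congr 2
        rw [hpdef]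
        field_simp
    _ ≤ ∫ r in Ioc (p * T) (T / 2), exp (-(a ^ 2 / (2 * r))) / r * volterra ((T - r) * lam) := by
        have hinv : IntegrableOn (fun r : ℝ => r⁻¹) (Ioc (p * T) (T / 2)) := by
          rw [← intervalIntegrable_iff_integrableOn_Ioc_of_le hle, intervalIntegrable_inv_iff,
            uIcc_of_le hle]
          exact Or.inr fun h => hlow.not_ge h.1
        refine setIntegral_mono_on (hinv.const_mul _) (hint.mono_set hsub)
          measurableSet_Ioc fun r hr => ?_
        have hr0 : 0 < r := hlow.trans hr.1
        have hv : volterra (T * lam / 2) ≤ volterra ((T - r) * lam) := by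
          have : 0 ≤ T - r := by linarith [hr.2]
          refine volterra_monotoneOn (mem_Ici.2 (by positivity)) (mem_Ici.2 (by positivity)) ?_
          nlinarith [hr.2]
        have hv0 : 0 ≤ volterra (T * lam / 2) := volterra_nonneg (by positivity)
        have he : a ^ 2 / (2 * r) ≤ 1 := by
          rw [div_le_one (by positivity)]
          have : p * T = a ^ 2 / 2 := by
            rw [hpdef]
            field_simp
          linarith [hr.1]
        calc _ = exp (-1) / r * volterra (T * lam / 2) := by ring
          _ ≤ _ := by gcongr
    _ ≤ _ := by
        refine setIntegral_mono_set hint ?_ hsub.eventuallyLE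
        filter_upwards [ae_restrict_mem measurableSet_Ioc] with r hr
        have hv := volterra_nonneg_of_mem hlam hr
        have hr0 := hr.1
        simp only [Pi.zero_apply]
        positivity

lemma one_add_logPlus_le (hT : 0 < T) (hlam : 0 < lam) (ha : 0 < a) :
    1 + logPlus (2 * T / a ^ 2) ≤ 32 * ((1 + logPlus (1 / (T * lam))) * (1 + Hbar T lam a)) := by
  set q := 1 + logPlus (1 / (T * lam)) with hq
  have hq1 : 1 ≤ q := by linarith [logPlus_nonneg (1 / (T * lam))]
  have hq0 : 0 < q := by linarith
  have hH := Hbar_nonneg (a := a) hT hlam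
  have hlog2 := log_two_lt_d9
  have hqH : 1 ≤ q * (1 + Hbar T lam a) := by nlinarith
  by_cases hp : a ^ 2 / (2 * T) ≤ 1 / 2
  · have h2 : 2 ≤ 2 * T / a ^ 2 := by
      rw [le_div_iff₀ (by positivity)]
      rw [div_le_iff₀ (by positivity)] at hp
      linarith
    have hl : log 2 ≤ log (2 * T / a ^ 2) := log_le_log two_pos h2
    have hl0 : 0 < log 2 := log_pos one_lt_two
    have h := le_Hbar hT hlam ha hp
    have hv := le_volterra_half (mul_pos hT hlam)
    rw [← hq] at hv
    have he : 1 / 16 ≤ exp (-1) * exp (-1) / 2 := by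
      have : (0.36 : ℝ) ≤ exp (-1) := by linarith [exp_neg_one_gt_d9]
      nlinarith
    have hlp : logPlus (2 * T / a ^ 2) = log (2 * T / a ^ 2) := max_eq_left (by linarith)
    rw [hlp]
    have key : 1 / 16 * (log (2 * T / a ^ 2) - log 2) ≤ q * Hbar T lam a := by
      calc _ ≤ exp (-1) * exp (-1) / 2 * (log (2 * T / a ^ 2) - log 2) := by
            have := sub_nonneg.2 hl
            gcongr
        _ = q * (exp (-1) * (exp (-1) / (2 * q)) * (log (2 * T / a ^ 2) - log 2)) := by
            field_simp
        _ ≤ q * (exp (-1) * volterra (T * lam / 2) * (log (2 * T / a ^ 2) - log 2)) := by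
            have := sub_nonneg.2 hl
            gcongr
        _ ≤ _ := by gcongr
    linarith
  · have h2 : 2 * T / a ^ 2 ≤ 2 := by
      rw [div_le_iff₀ (by positivity)]
      rw [not_le, lt_div_iff₀ (by positivity)] at hp
      linarith
    have : logPlus (2 * T / a ^ 2) ≤ 1 :=
      max_le ((log_le_log (by positivity) h2).trans (by linarith)) zero_le_one
    linarith

end

/-- For every `L > 0` there is `C_L > 0` such that for all `a > 0` and `T, λ > 0` with `Tλ ≤ L`:
`b̄_T^λ(a) ≤ (C_L/a) (e^{−a²/(2T)}/(1+log⁺(1/(Tλ))))` when `a² ≥ 2T²λ`, and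
`b̄_T^λ(a) ≤ (C_L/a) (1/(1+log⁺(2T/a²)))` when `a² < 2T²λ`. -/
theorem bbar_upper_bound (L : ℝ) (hL : 0 < L) :
    ∃ C > 0, ∀ T lam a : ℝ, 0 < T → 0 < lam → 0 < a → T * lam ≤ L →
      bbar T lam a ≤ (C / a) *
        (if 2 * T ^ 2 * lam ≤ a ^ 2 then
          Real.exp (-(a ^ 2 / (2 * T))) / (1 + logPlus (1 / (T * lam)))
        else 1 / (1 + logPlus (2 * T / a ^ 2))) := by
  obtain ⟨M, hM1, hML⟩ : ∃ M, 1 ≤ M ∧ L ≤ M := ⟨max 1 L, le_max_left _ _, le_max_right _ _⟩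
  refine ⟨64 * exp (exp 1 * M), by positivity, fun T lam a hT hlam ha hL' => ?_⟩
  have hH := Hbar_nonneg (a := a) hT hlam
  have hq0 := logPlus_nonneg (1 / (T * lam))
  have hp0 := logPlus_nonneg (2 * T / a ^ 2)
  have hv := volterra_le hM1 (mul_pos hT hlam).le (hL'.trans hML)
  have hb : bbar T lam a ≤ (2 / a * (exp (exp 1 * M) / (1 + logPlus (1 / (T * lam)))) *
      exp (-(a ^ 2 / (2 * T)))) / (1 + Hbar T lam a) := by
    unfold bbar
    gcongr
    exact (neg_deriv_Hbar_le hT hlam ha).trans (by gcongr)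
  refine hb.trans ?_
  split_ifs
  · refine (div_le_self (by positivity) (by linarith)).trans ?_
    calc _ = 2 * exp (exp 1 * M) / a *
          (exp (-(a ^ 2 / (2 * T))) / (1 + logPlus (1 / (T * lam)))) := by ring
      _ ≤ _ := by
          gcongr
          norm_num
  · calc _ ≤ 2 / a * (exp (exp 1 * M) / (1 + logPlus (1 / (T * lam)))) * 1 /
          (1 + Hbar T lam a) := by
          gcongr
          exact exp_le_one_iff.2 (neg_nonpos.2 (by positivity))
      _ = 2 * exp (exp 1 * M) / a *
          (1 / ((1 + logPlus (1 / (T * lam))) * (1 + Hbar T lam a))) := by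
          field_simp
      _ ≤ 2 * exp (exp 1 * M) / a * (32 * (1 / (1 + logPlus (2 * T / a ^ 2)))) := by
          gcongr
          rw [mul_one_div, div_le_div_iff₀ (by positivity) (by positivity), one_mul]
          exact one_add_logPlus_le hT hlam ha
      _ = _ := by ring
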